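/- Let S be a positive integer, P : Fin S → Fin S → ℝ with P s s' ≥ 0 for all s, s', let α ≥ 0, θ ∈ [0,1], η ≥ 0, X : Fin S → ℝ, and let d : ℕ → Fin S → ℝ be such that for each channel state s' the map q ↦ d(q,s') is monotone nondecreasing. Define ΔV(q,s) = η·X s − α·Σ_{s'} P s s' ·(θ·d(q+1,s') + (1−θ)·d(q,s')). Then: (i) for each s, the map q ↦ ΔV(q,s) is antitone (monotone nonincreasing); and (ii) for each s there exists a threshold L s ∈ ℕ∞ (i.e. WithTop ℕ) such that for every q ∈ ℕ, ΔV(q,s) < 0 if and only if L s ≤ q. Hence the policy that transmits exactly when ΔV(q,s) < 0 is a queue-length threshold policy. -/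

import Mathlib

open Finset

/-- The strict sublevel set of an antitone sequence is a (possibly empty) upper ray of `ℕ`. -/
theorem Antitone.exists_enat_lt_iff_le {β : Type*} [Preorder β] {f : ℕ → β} (hf : Antitone f)
    (c : β) : ∃ L : ℕ∞, ∀ q : ℕ, f q < c ↔ L ≤ (q : ℕ∞) := by
  classical
  by_cases h : ∃ q, f q < c
  · refine ⟨(Nat.find h : ℕ), fun q => ?_⟩
    rw [Nat.cast_le]
    exact ⟨fun hq => Nat.find_min' h hq, fun hq => (hf hq).trans_lt (Nat.find_spec h)⟩
  · exact ⟨⊤, fun q => iff_of_false (fun hq => h ⟨q, hq⟩) (by simp)⟩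

/-- Theorem 1 (threshold structure).  If the value-function differences
`d q s'` are nondecreasing in the queue length `q`, then the Bellman-branch
difference `ΔV(q,s) = η·X s − α·Σ_{s'} P s s'·(θ·d(q+1,s') + (1−θ)·d(q,s'))`
is antitone in `q`, and for each channel state `s` there is a queue-length
threshold `L s ∈ ℕ∞` with `ΔV(q,s) < 0 ↔ L s ≤ q`. -/
theorem threshold_structure (S : ℕ) (hS : 0 < S)
    (P : Fin S → Fin S → ℝ) (hP : ∀ s s', 0 ≤ P s s')
    (α : ℝ) (hα : 0 ≤ α) (θ : ℝ) (hθ0 : 0 ≤ θ) (hθ1 : θ ≤ 1)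
    (η : ℝ) (hη : 0 ≤ η) (X : Fin S → ℝ)
    (d : ℕ → Fin S → ℝ) (hd : ∀ s', Monotone fun q => d q s') :
    (∀ s, Antitone fun q =>
      η * X s - α * ∑ s' : Fin S, P s s' * (θ * d (q + 1) s' + (1 - θ) * d q s')) ∧
    (∀ s, ∃ L : ℕ∞, ∀ q : ℕ,
      (η * X s - α * ∑ s' : Fin S, P s s' * (θ * d (q + 1) s' + (1 - θ) * d q s') < 0)
        ↔ L ≤ (q : ℕ∞)) := by
  have key : ∀ s, Antitone fun q =>
      η * X s - α * ∑ s' : Fin S, P s s' * (θ * d (q + 1) s' + (1 - θ) * d q s') := by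
    intro s a b hab
    refine sub_le_sub_left (mul_le_mul_of_nonneg_left (Finset.sum_le_sum fun s' _ => ?_) hα) _
    exact mul_le_mul_of_nonneg_left
      (add_le_add (mul_le_mul_of_nonneg_left (hd s' (Nat.succ_le_succ hab)) hθ0)
        (mul_le_mul_of_nonneg_left (hd s' hab) (sub_nonneg.mpr hθ1))) (hP s s')
  exact ⟨key, fun s => (key s).exists_enat_lt_iff_le 0⟩
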